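/- For all integers $m$ and $n$, the number $N(m,n)$ of partitions of $n$ with rank equal to $m$ satisfies $N(m,n) \leq p(n - 1 - |m|) - p(n - 2 - |m|)$, with equality whenever $|m| \geq n/2 - 2$; here $p$ is the partition function with $p(0) = 1$ and $p(x) = 0$ for $x$ not a non-negative integer. -/

import Mathlib

/-- The Dyson rank of a partition: its largest part minus its number of parts. -/
def Nat.Partition.rank {n : ℕ} (l : n.Partition) : ℤ :=
  (l.parts.sup : ℤ) - l.parts.card

/-- The partition function `p`, extended to the integers by `p(x) = 0` when `x` is not a
non-negative integer (and `p 0 = 1`, counting the empty partition). -/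
noncomputable def partitionFn (n : ℤ) : ℕ :=
  if 0 ≤ n then Nat.card (Nat.Partition n.toNat) else 0

/-- `N m n`: the number of partitions of `n` with rank exactly `m`
(`0` when `n` is not a positive integer). -/
noncomputable def rankCount (m n : ℤ) : ℕ :=
  if 0 < n then Nat.card {l : Nat.Partition n.toNat // l.rank = m} else 0

namespace YoungDiagram

theorem sum_rowLens (μ : YoungDiagram) : μ.rowLens.sum = μ.card := by
  have hmem : ∀ c ∈ μ.cells, c.1 ∈ Finset.range (μ.colLen 0) := fun c hc => by
    have : (c.1, 0) ∈ μ := μ.up_left_mem le_rfl (Nat.zero_le c.2) hc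
    simpa [mem_iff_lt_colLen] using this
  rw [YoungDiagram.card, Finset.card_eq_sum_card_fiberwise hmem, rowLens]
  calc (List.map μ.rowLen (List.range (μ.colLen 0))).sum
      = ∑ i ∈ Finset.range (μ.colLen 0), μ.rowLen i := rfl
    _ = _ := Finset.sum_congr rfl fun i _ => μ.rowLen_eq_card

theorem sup_rowLens (μ : YoungDiagram) : (μ.rowLens : Multiset ℕ).sup = μ.rowLen 0 := by
  apply le_antisymm
  · refine Multiset.sup_le.2 fun x hx => ?_
    obtain ⟨i, -, rfl⟩ := List.mem_map.1 (Multiset.mem_coe.1 hx)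
    exact μ.rowLen_anti 0 i i.zero_le
  · rcases Nat.eq_zero_or_pos (μ.rowLen 0) with h | h
    · simp [h]
    · refine Multiset.le_sup (Multiset.mem_coe.2 (List.mem_map.2 ⟨0, ?_, rfl⟩))
      rwa [List.mem_range, ← mem_iff_lt_colLen, mem_iff_lt_rowLen]

end YoungDiagram

namespace Nat.Partition

/-- Partitions of `n` correspond to Young diagrams with `n` cells. -/
def equivYoungDiagram (n : ℕ) : n.Partition ≃ {μ : YoungDiagram // μ.card = n} where
  toFun l :=
    ⟨YoungDiagram.ofRowLens (l.parts.sort (· ≥ ·)) (Multiset.pairwise_sort _ _).sortedGE, by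
      rw [← YoungDiagram.sum_rowLens, YoungDiagram.rowLens_ofRowLens_eq_self
        fun x hx => l.parts_pos ((Multiset.mem_sort _).1 hx), ← Multiset.sum_coe, Multiset.sort_eq,
        l.parts_sum]⟩
  invFun μ :=
    { parts := μ.1.rowLens
      parts_pos := fun h => μ.1.pos_of_mem_rowLens _ h
      parts_sum := by rw [Multiset.sum_coe, μ.1.sum_rowLens, μ.2] }
  left_inv l := by
    ext1
    simp only
    rw [YoungDiagram.rowLens_ofRowLens_eq_self
      fun x hx => l.parts_pos ((Multiset.mem_sort _).1 hx), Multiset.sort_eq]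
  right_inv μ := by
    apply Subtype.ext
    simp only [Multiset.coe_sort]
    convert YoungDiagram.ofRowLens_to_rowLens_eq_self (μ := μ.1)
    exact List.mergeSort_of_pairwise (by simpa using μ.1.rowLens_sorted.pairwise)

theorem rank_equivYoungDiagram_symm {n : ℕ} (μ : {μ : YoungDiagram // μ.card = n}) :
    ((equivYoungDiagram n).symm μ).rank = μ.1.rowLen 0 - μ.1.colLen 0 := by
  simp only [rank, equivYoungDiagram, Equiv.coe_fn_symm_mk, YoungDiagram.sup_rowLens,
    Multiset.coe_card, YoungDiagram.length_rowLens]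

/-- The conjugate partition, obtained by reflecting the Young diagram. -/
def conjugate {n : ℕ} : n.Partition ≃ n.Partition :=
  (equivYoungDiagram n).trans <|
    (YoungDiagram.transposeOrderIso.toEquiv.subtypeEquiv fun μ => by
      simp [YoungDiagram.card, YoungDiagram.transpose]).trans (equivYoungDiagram n).symm

theorem rank_conjugate {n : ℕ} (l : n.Partition) : (conjugate l).rank = -l.rank := by
  obtain ⟨μ, rfl⟩ := (equivYoungDiagram n).symm.surjective l
  simp [conjugate, rank_equivYoungDiagram_symm]

theorem card_rank_eq_neg (n : ℕ) (m : ℤ) :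
    Nat.card {l : n.Partition // l.rank = -m} = Nat.card {l : n.Partition // l.rank = m} :=
  (Nat.card_congr (conjugate.subtypeEquiv fun l => by rw [rank_conjugate]; omega)).symm

theorem sup_mem_parts {n : ℕ} (hn : 0 < n) (l : n.Partition) : l.parts.sup ∈ l.parts := by
  have hne : l.parts.toFinset.Nonempty := by
    rw [Multiset.toFinset_nonempty]
    intro h
    have := l.parts_sum
    simp [h] at this
    omega
  obtain ⟨i, hi, hi'⟩ := Finset.exists_mem_eq_sup _ hne id
  rw [Finset.sup_def, Multiset.map_id, Multiset.toFinset_val, Multiset.sup_dedup] at hi'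
  rw [hi']
  exact Multiset.mem_toFinset.1 hi

theorem card_parts_pos {n : ℕ} (hn : 0 < n) (l : n.Partition) : 0 < l.parts.card :=
  Multiset.card_pos_iff_exists_mem.2 ⟨_, sup_mem_parts hn l⟩

theorem card_one_notMem_parts (n : ℕ) :
    Nat.card {l : (n + 1).Partition // 1 ∉ l.parts} + Nat.card n.Partition =
      Nat.card (n + 1).Partition := by
  have h := Nat.card_congr (partitionWithPartEquiv (n := n + 1) le_rfl (by omega))
  rw [Nat.add_sub_cancel] at h
  rw [← h, add_comm, ← Nat.card_sum]
  exact Nat.card_congr (Equiv.sumCompl _)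

theorem sum_map_succ (s : Multiset ℕ) : (s.map (· + 1)).sum = s.sum + s.card := by
  simp [Multiset.sum_map_add]

theorem sum_map_pred {s : Multiset ℕ} (hs : ∀ i ∈ s, 0 < i) :
    (s.map (· - 1)).sum + s.card = s.sum := by
  rw [← Multiset.card_map (· - 1) s, ← sum_map_succ, Multiset.map_map]
  congr 1
  exact (Multiset.map_congr rfl fun i hi => Nat.sub_add_cancel (hs i hi)).trans (Multiset.map_id s)

/-- Deleting the largest part of a partition of rank `m ≥ 0` and adding `1` to every other part
gives a partition with no part equal to `1`. -/
def rankEquiv (N m : ℕ) :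
    {l : (N + 1 + m).Partition // l.rank = m} ≃
      {l : N.Partition // 1 ∉ l.parts ∧ l.parts.sup ≤ l.parts.card + m + 2} where
  toFun l :=
    have hmem := sup_mem_parts (by omega) l.1
    have hcard : (l.1.parts.erase l.1.parts.sup).card + 1 = l.1.parts.card :=
      Multiset.card_erase_add_one hmem
    have hrank : l.1.parts.sup = l.1.parts.card + m := by
      have := l.2
      simp only [rank] at this
      omega
    ⟨{ parts := (l.1.parts.erase l.1.parts.sup).map (· + 1)
       parts_pos := by simp +contextual
       parts_sum := by
        have h := Multiset.sum_erase hmem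
        rw [l.1.parts_sum] at h
        rw [sum_map_succ]
        omega },
      by
        refine ⟨fun h => ?_, Multiset.sup_le.2 fun x hx => ?_⟩
        · obtain ⟨i, hi, hi'⟩ := Multiset.mem_map.1 h
          have := l.1.parts_pos (Multiset.mem_of_mem_erase hi)
          omega
        · obtain ⟨i, hi, rfl⟩ := Multiset.mem_map.1 hx
          have := Multiset.le_sup (Multiset.mem_of_mem_erase hi)
          rw [Multiset.card_map]
          omega⟩
  invFun l :=
    have hpos : ∀ i ∈ l.1.parts, 1 < i := fun i hi => by
      have := l.1.parts_pos hi
      have : i ≠ 1 := fun h => l.2.1 (h ▸ hi)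
      omega
    ⟨{ parts := (l.1.parts.card + 1 + m) ::ₘ l.1.parts.map (· - 1)
       parts_pos := fun {i} hi => by
        rcases Multiset.mem_cons.1 hi with rfl | hi
        · omega
        · obtain ⟨j, hj, rfl⟩ := Multiset.mem_map.1 hi
          have := hpos j hj
          omega
       parts_sum := by
        have := sum_map_pred fun i hi => l.1.parts_pos (i := i) hi
        rw [l.1.parts_sum] at this
        rw [Multiset.sum_cons]
        omega },
      by
        have hsup : (l.1.parts.map (· - 1)).sup ≤ l.1.parts.card + 1 + m := by
          refine Multiset.sup_le.2 fun x hx => ?_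
          obtain ⟨i, hi, rfl⟩ := Multiset.mem_map.1 hx
          have := Multiset.le_sup hi
          have := l.2.2
          omega
        simp only [rank, Multiset.sup_cons, sup_eq_left.2 hsup, Multiset.card_cons,
          Multiset.card_map]
        push_cast
        ring⟩
  left_inv l := by
    have hmem := sup_mem_parts (by omega) l.1
    have hcard : (l.1.parts.erase l.1.parts.sup).card + 1 = l.1.parts.card :=
      Multiset.card_erase_add_one hmem
    have hrank : l.1.parts.sup = l.1.parts.card + m := by
      have := l.2
      simp only [rank] at this
      omega
    apply Subtype.ext
    ext1
    simp only [Multiset.card_map, Multiset.map_map, hcard, ← hrank, Function.comp_def,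
      Nat.add_sub_cancel, Multiset.map_id', Multiset.cons_erase hmem]
  right_inv l := by
    have hsup : (l.1.parts.map (· - 1)).sup ≤ l.1.parts.card + 1 + m := by
      refine Multiset.sup_le.2 fun x hx => ?_
      obtain ⟨i, hi, rfl⟩ := Multiset.mem_map.1 hx
      have := Multiset.le_sup hi
      have := l.2.2
      omega
    apply Subtype.ext
    ext1
    simp only [Multiset.sup_cons, sup_eq_left.2 hsup, Multiset.erase_cons_head, Multiset.map_map]
    exact (Multiset.map_congr rfl fun i hi => Nat.sub_add_cancel (l.1.parts_pos hi)).trans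
      (Multiset.map_id _)

theorem sup_parts_le {n m : ℕ} (h : n ≤ m + 3) (l : n.Partition) :
    l.parts.sup ≤ l.parts.card + m + 2 := by
  refine Multiset.sup_le.2 fun x hx => ?_
  have := l.le_of_mem_parts hx
  have := Multiset.card_pos_iff_exists_mem.2 ⟨x, hx⟩
  omega

end Nat.Partition

open Nat.Partition

theorem rankCount_abs (m n : ℤ) : rankCount |m| n = rankCount m n := by
  rcases abs_choice m with h | h <;> rw [h]
  simp only [rankCount, card_rank_eq_neg]

theorem rankCount_eq_zero {m : ℕ} {n : ℤ} (h : n ≤ m) : rankCount m n = 0 := by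
  rw [rankCount]
  split_ifs with hn
  · have : IsEmpty {l : Nat.Partition n.toNat // l.rank = m} := by
      refine ⟨fun ⟨l, hl⟩ => ?_⟩
      have hn' : 0 < n.toNat := by omega
      have := l.le_of_mem_parts (sup_mem_parts hn' l)
      have := card_parts_pos hn' l
      rw [rank] at hl
      omega
    exact Nat.card_of_isEmpty
  · rfl

theorem rankCount_eq (N m : ℕ) :
    rankCount m (N + 1 + m : ℕ) =
      Nat.card {l : N.Partition // 1 ∉ l.parts ∧ l.parts.sup ≤ l.parts.card + m + 2} := by
  rw [rankCount, if_pos (by omega), Int.toNat_natCast]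
  exact Nat.card_congr (rankEquiv N m)

theorem card_one_notMem_parts_eq (N : ℕ) :
    (Nat.card {l : N.Partition // 1 ∉ l.parts} : ℤ) = partitionFn N - partitionFn (N - 1) := by
  cases N with
  | zero =>
    simp [partitionFn]
  | succ k =>
    have := card_one_notMem_parts k
    have e : ((k + 1 : ℕ) : ℤ) - 1 = k := by omega
    rw [e, partitionFn, partitionFn, if_pos (by omega), if_pos (by omega), Int.toNat_natCast,
      Int.toNat_natCast]
    omega

theorem rankCount_le_partitionFn_sub (m n : ℤ) :
    (rankCount m n : ℤ) ≤ (partitionFn (n - 1 - |m|) : ℤ) - (partitionFn (n - 2 - |m|) : ℤ) ∧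
      ((n : ℚ) / 2 - 2 ≤ (|m| : ℚ) →
        (rankCount m n : ℤ)
          = (partitionFn (n - 1 - |m|) : ℤ) - (partitionFn (n - 2 - |m|) : ℤ)) := by
  rw [← rankCount_abs, ← Int.cast_abs]
  obtain ⟨k, hk⟩ := Int.eq_ofNat_of_zero_le (abs_nonneg m)
  rw [hk]
  rcases le_or_gt n k with h | h
  · rw [rankCount_eq_zero h, partitionFn, partitionFn, if_neg (by omega), if_neg (by omega)]
    simp
  · obtain ⟨N, rfl⟩ : ∃ N : ℕ, n = (N + 1 + k : ℕ) := ⟨(n - 1 - k).toNat, by omega⟩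
    have e₁ : ((N + 1 + k : ℕ) : ℤ) - 1 - k = N := by omega
    have e₂ : ((N + 1 + k : ℕ) : ℤ) - 2 - k = N - 1 := by omega
    rw [e₁, e₂, ← card_one_notMem_parts_eq, rankCount_eq]
    refine ⟨?_, fun hle => ?_⟩
    · exact Int.ofNat_le.2 <| Nat.card_le_card_of_injective _
        (Subtype.impEmbedding
          (fun l : N.Partition => 1 ∉ l.parts ∧ l.parts.sup ≤ l.parts.card + k + 2) _
          fun _ hl => hl.1).injective
    · have hN : N ≤ k + 3 := by
        push_cast at hle
        have : (N : ℚ) ≤ k + 3 := by linarith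
        exact_mod_cast this
      simp only [sup_parts_le hN, and_true]
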